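/- arXiv:2602.08215 — 4 statements merged into one kernel-verified Lean document; each statement's English description precedes it below -/
import Mathlib

section
/- Let d ≥ 1, s ∈ ℝ, τ ≥ 0, N ≥ 1 a natural number, and q, B ≥ 0. Let g, u : ℤ^d → ℝ satisfy (i) the truncated score bound ∑_{n ∈ ℤ^d, ‖n‖_∞ ≤ N} w_{s−τ}(n) (g(n) − u(n))² ≤ q, and (ii) the smoothness bound ∑_{n ∈ ℤ^d} w_s(n) u(n)² ≤ B (with the relevant series of nonnegative terms convergent), and suppose g(n) = 0 for ‖n‖_∞ > N. Then the full (untruncated) score satisfies ∑_{n ∈ ℤ^d} w_{s−τ}(n) (g(n) − u(n))² ≤ q + B · N^{−2τ}. -/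
open scoped BigOperators

/-- Squared Euclidean norm of a lattice point `n ∈ ℤ^d`, viewed in `ℝ^d`. -/
noncomputable def latNormSq {d : ℕ} (n : Fin d → ℤ) : ℝ := ∑ i, ((n i : ℝ)) ^ 2

/-- Sobolev weight `w_r(n) = (1 + ‖n‖₂²)^r`. -/
noncomputable def sobWeight {d : ℕ} (r : ℝ) (n : Fin d → ℤ) : ℝ := (1 + latNormSq n) ^ r

/-- Max (sup) norm `‖n‖_∞` of a lattice point, as a natural number. -/
def supNorm {d : ℕ} (n : Fin d → ℤ) : ℕ := Finset.univ.sup fun i => (n i).natAbs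

theorem latNormSq_nonneg {d : ℕ} (n : Fin d → ℤ) : 0 ≤ latNormSq n :=
  Finset.sum_nonneg fun _ _ => sq_nonneg _

theorem sobWeight_nonneg {d : ℕ} (r : ℝ) (n : Fin d → ℤ) : 0 ≤ sobWeight r n :=
  Real.rpow_nonneg (add_nonneg zero_le_one (latNormSq_nonneg n)) r

/-- The max norm is dominated by the Euclidean norm. -/
theorem sq_le_latNormSq_of_lt_supNorm {d N : ℕ} {n : Fin d → ℤ} (h : N < supNorm n) :
    (N : ℝ) ^ 2 ≤ latNormSq n := by
  obtain ⟨i, -, hi⟩ := Finset.lt_sup_iff.mp h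
  have hN : (N : ℝ) ≤ |(n i : ℝ)| := by
    rw [← Int.cast_abs, Int.abs_eq_natAbs]
    exact_mod_cast hi.le
  calc (N : ℝ) ^ 2 ≤ |(n i : ℝ)| ^ 2 := by gcongr
    _ = (n i : ℝ) ^ 2 := sq_abs _
    _ ≤ latNormSq n :=
      Finset.single_le_sum (f := fun j => (n j : ℝ) ^ 2) (fun _ _ => sq_nonneg _)
        (Finset.mem_univ i)

/-- Lowering the Sobolev order by `τ` gains a factor `N ^ (-2τ)` on frequencies above `N`. -/
theorem sobWeight_sub_le {d N : ℕ} (hN : 1 ≤ N) (s : ℝ) {τ : ℝ} (hτ : 0 ≤ τ) {n : Fin d → ℤ}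
    (h : N < supNorm n) :
    sobWeight (s - τ) n ≤ sobWeight s n * (N : ℝ) ^ (-(2 * τ)) := by
  have hpos : 0 < 1 + latNormSq n := add_pos_of_pos_of_nonneg one_pos (latNormSq_nonneg n)
  have hN0 : (0 : ℝ) < N := by exact_mod_cast hN
  have hpow : (N : ℝ) ^ (-(2 * τ)) = ((N : ℝ) ^ 2) ^ (-τ) := by
    rw [← Real.rpow_natCast, ← Real.rpow_mul hN0.le]
    congr 1
    push_cast
    ring
  have hle : (N : ℝ) ^ 2 ≤ 1 + latNormSq n := by
    linarith [sq_le_latNormSq_of_lt_supNorm h]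
  rw [sobWeight, sub_eq_add_neg, Real.rpow_add hpos, hpow]
  exact mul_le_mul_of_nonneg_left
    (Real.rpow_le_rpow_of_nonpos (by positivity) hle (neg_nonpos.mpr hτ)) (sobWeight_nonneg s n)

/-- the full (untruncated) score is bounded by the truncated score
plus a decaying margin. -/
theorem full_score_bound (d : ℕ) (hd : 1 ≤ d) (s τ : ℝ) (hτ : 0 ≤ τ)
    (N : ℕ) (hN : 1 ≤ N) (q B : ℝ) (hq : 0 ≤ q) (hB : 0 ≤ B)
    (g u : (Fin d → ℤ) → ℝ)
    (hscore : ∑' n : {n : Fin d → ℤ // supNorm n ≤ N},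
        sobWeight (s - τ) n.1 * (g n.1 - u n.1) ^ 2 ≤ q)
    (husum : Summable fun n : Fin d → ℤ => sobWeight s n * u n ^ 2)
    (hubound : ∑' n : Fin d → ℤ, sobWeight s n * u n ^ 2 ≤ B)
    (hg : ∀ n : Fin d → ℤ, N < supNorm n → g n = 0) :
    ∑' n : Fin d → ℤ, sobWeight (s - τ) n * (g n - u n) ^ 2
      ≤ q + B * (N : ℝ) ^ (-(2 * τ)) := by
  have hc : 0 ≤ (N : ℝ) ^ (-(2 * τ)) := by positivity
  by_cases hsum : Summable fun n : Fin d → ℤ => sobWeight (s - τ) n * (g n - u n) ^ 2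
  · rw [← hsum.tsum_subtype_add_tsum_subtype_compl {n | supNorm n ≤ N}]
    refine add_le_add hscore ?_
    calc _ ≤ ∑' n : ↥{n : Fin d → ℤ | supNorm n ≤ N}ᶜ,
          sobWeight s n.1 * u n.1 ^ 2 * (N : ℝ) ^ (-(2 * τ)) := by
          refine (hsum.subtype _).tsum_le_tsum (fun n => ?_) ((husum.mul_right _).subtype _)
          have hn : N < supNorm n.1 := not_le.mp n.2
          rw [hg n.1 hn, zero_sub, neg_sq, mul_right_comm]
          exact mul_le_mul_of_nonneg_right (sobWeight_sub_le hN s hτ hn) (sq_nonneg _)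
      _ ≤ ∑' n : Fin d → ℤ, sobWeight s n * u n ^ 2 * (N : ℝ) ^ (-(2 * τ)) :=
          (husum.mul_right _).tsum_subtype_le _ _ fun n =>
            mul_nonneg (mul_nonneg (sobWeight_nonneg s n) (sq_nonneg _)) hc
      _ ≤ B * (N : ℝ) ^ (-(2 * τ)) := by
          rw [tsum_mul_right]
          exact mul_le_mul_of_nonneg_right hubound hc
  · rw [tsum_eq_zero_of_not_summable hsum]
    positivity
end

section
/- Let Y be a real normed vector space, W a nonempty set, L ≥ 0, and J : W × Y → ℝ satisfy |J(w,y) − J(w,y')| ≤ L‖y − y'‖ for all w ∈ W and y, y' ∈ Y. Let ĝ ∈ Y, r ≥ 0, and let C := {y ∈ Y : ‖y − ĝ‖ ≤ r} be the closed ball of radius r about ĝ. Suppose u ∈ C, and suppose w ↦ J(w,u) is bounded below on W. Then the robust suboptimality gap Δ := inf_{w ∈ W} sup_{y ∈ C} J(w,y) − inf_{w ∈ W} J(w,u) satisfies 0 ≤ Δ ≤ 2Lr. -/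
/-- deterministic suboptimality bound for the robust min–max decision
over a norm ball uncertainty region containing the true parameter. -/
theorem robust_suboptimality_ball
    {Y : Type*} [NormedAddCommGroup Y] [NormedSpace ℝ Y]
    {W : Type*} [Nonempty W]
    (L : ℝ) (hL : 0 ≤ L) (J : W → Y → ℝ)
    (hlip : ∀ (w : W) (y y' : Y), |J w y - J w y'| ≤ L * ‖y - y'‖)
    (ghat : Y) (r : ℝ) (hr : 0 ≤ r) (u : Y)
    (hu : u ∈ Metric.closedBall ghat r)
    (hbdd : BddBelow (Set.range fun w => J w u)) :
    0 ≤ (⨅ w : W, ⨆ y : Metric.closedBall ghat r, J w y.1) - (⨅ w : W, J w u) ∧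
      (⨅ w : W, ⨆ y : Metric.closedBall ghat r, J w y.1) - (⨅ w : W, J w u)
        ≤ 2 * L * r := by
  have h_upper (w : W) (y : Metric.closedBall ghat r) : J w y.1 ≤ J w u + 2 * L * r := by
    have h_dist : ‖y.1 - u‖ ≤ r + r := by
      rw [← dist_eq_norm]
      exact (dist_triangle_right _ _ ghat).trans (add_le_add y.2 hu)
    have h_scaled := mul_le_mul_of_nonneg_left h_dist hL
    linarith [le_of_abs_le (hlip w y.1 u)]
  have h_lower (w : W) : J w u ≤ ⨆ y : Metric.closedBall ghat r, J w y.1 :=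
    le_ciSup (f := fun y : Metric.closedBall ghat r => J w y.1)
      ⟨_, Set.forall_mem_range.2 (h_upper w)⟩ ⟨u, hu⟩
  have h_sup_bdd : BddBelow (Set.range fun w => ⨆ y : Metric.closedBall ghat r, J w y.1) := by
    obtain ⟨b, hb⟩ := hbdd
    exact ⟨b, Set.forall_mem_range.2 fun w => (hb ⟨w, rfl⟩).trans (h_lower w)⟩
  have : Nonempty (Metric.closedBall ghat r) := ⟨⟨u, hu⟩⟩
  refine ⟨sub_nonneg.2 (ciInf_mono hbdd h_lower), ?_⟩
  rw [sub_le_comm]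
  refine le_ciInf fun w => ?_
  rw [sub_le_iff_le_add]
  exact (ciInf_le h_sup_bdd w).trans (ciSup_le (h_upper w))
end

section
/- Let E be a real inner product space, W ⊆ E a convex set, μ > 0, ε ≥ 0, and let φ, ψ : E → ℝ satisfy φ(w) ≤ ψ(w) ≤ φ(w) + ε for all w ∈ W. Suppose ψ is μ-strongly convex on W (i.e., w ↦ ψ(w) − (μ/2)‖w‖² is convex on W). Let w_φ ∈ W be a minimizer of φ over W and w_ψ ∈ W a minimizer of ψ over W. Then ‖w_φ − w_ψ‖² ≤ 2ε/μ. -/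
/-- Quadratic growth of a strongly convex function at a minimizer over a set. -/
theorem StrongConvexOn.quadratic_growth
    {E : Type*} [NormedAddCommGroup E] [NormedSpace ℝ E] {s : Set E} {m : ℝ} {f : E → ℝ}
    (hf : StrongConvexOn s m f) {x y : E} (hx : x ∈ s) (hy : y ∈ s) (hmin : IsMinOn f s x) :
    m / 2 * ‖y - x‖ ^ 2 ≤ f y - f x := by
  have hlim : Filter.Tendsto (fun t : ℝ => (1 - t) * (m / 2 * ‖y - x‖ ^ 2))
      (nhdsWithin 0 (Set.Ioi 0)) (nhds (m / 2 * ‖y - x‖ ^ 2)) := by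
    have hcont : Continuous fun t : ℝ => (1 - t) * (m / 2 * ‖y - x‖ ^ 2) := by fun_prop
    simpa using (hcont.tendsto 0).mono_left nhdsWithin_le_nhds
  refine le_of_tendsto hlim ?_
  filter_upwards [Ioo_mem_nhdsGT (zero_lt_one' ℝ)] with t ht
  have ht' : 0 ≤ 1 - t := sub_nonneg.2 ht.2.le
  have hconv := hf.2 hy hx ht.1.le ht' (add_sub_cancel t 1)
  have hle := hmin (hf.1 hy hx ht.1.le ht' (add_sub_cancel t 1))
  simp only [Set.mem_ofPred_eq, smul_eq_mul] at hconv hle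
  refine le_of_mul_le_mul_left ?_ ht.1
  linarith

/-- minimizer stability for sandwiched objectives with a strongly
convex upper envelope. -/
theorem minimizer_stability
    {E : Type*} [NormedAddCommGroup E] [InnerProductSpace ℝ E]
    (W : Set E) (hW : Convex ℝ W) (μ ε : ℝ) (hμ : 0 < μ) (hε : 0 ≤ ε)
    (φ ψ : E → ℝ)
    (hsand : ∀ w ∈ W, φ w ≤ ψ w ∧ ψ w ≤ φ w + ε)
    (hstrong : ConvexOn ℝ W fun w => ψ w - μ / 2 * ‖w‖ ^ 2)
    (wφ wψ : E) (hwφ : wφ ∈ W) (hwψ : wψ ∈ W)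
    (hminφ : ∀ w ∈ W, φ wφ ≤ φ w) (hminψ : ∀ w ∈ W, ψ wψ ≤ ψ w) :
    ‖wφ - wψ‖ ^ 2 ≤ 2 * ε / μ := by
  have hgrowth := (strongConvexOn_iff_convex.2 hstrong).quadratic_growth hwψ hwφ hminψ
  rw [le_div_iff₀ hμ]
  linarith [(hsand wφ hwφ).2, hminφ wψ hwψ, (hsand wψ hwψ).1]
end

section
/- Let H be a complex inner product space, M ≥ 1 a natural number, and q ≥ 0. Let ψ : Fin M → H with ‖ψ_k‖ = 1 for all k, and Δ : Fin M → H with ‖Δ_k‖² ≤ q for all k. Define the M × M matrices G_{ℓ,k} := ⟨ψ_ℓ, ψ_k⟩ and Ĝ_{ℓ,k} := ⟨ψ_ℓ + Δ_ℓ, ψ_k + Δ_k⟩. Then the squared Frobenius distance satisfies ∑_{ℓ,k} |Ĝ_{ℓ,k} − G_{ℓ,k}|² ≤ 3M²(2q + q²). -/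
open scoped ComplexInnerProductSpace BigOperators

/-- Entrywise perturbation bound for the inner product of two unit vectors. -/
theorem norm_inner_add_add_sub_inner_sq_le
    {H : Type*} [NormedAddCommGroup H] [InnerProductSpace ℂ H]
    {q : ℝ} {x y u v : H} (hx : ‖x‖ = 1) (hy : ‖y‖ = 1)
    (hu : ‖u‖ ^ 2 ≤ q) (hv : ‖v‖ ^ 2 ≤ q) :
    ‖inner ℂ (x + u) (y + v) - inner ℂ x y‖ ^ 2 ≤ 3 * (2 * q + q ^ 2) := by
  have expand : inner ℂ (x + u) (y + v) - inner ℂ x y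
      = inner ℂ x v + inner ℂ u y + inner ℂ u v := by
    simp only [inner_add_left, inner_add_right]
    ring
  have bound : ‖inner ℂ (x + u) (y + v) - inner ℂ x y‖ ≤ ‖v‖ + ‖u‖ + ‖u‖ * ‖v‖ := by
    rw [expand]
    refine norm_add₃_le.trans (add_le_add_three ?_ ?_ (norm_inner_le_norm u v))
    · simpa [hx] using norm_inner_le_norm (𝕜 := ℂ) x v
    · simpa [hy] using norm_inner_le_norm (𝕜 := ℂ) u y
  have huv : ‖u‖ ^ 2 * ‖v‖ ^ 2 ≤ q * q :=
    mul_le_mul hu hv (sq_nonneg _) ((sq_nonneg _).trans hu)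
  calc ‖inner ℂ (x + u) (y + v) - inner ℂ x y‖ ^ 2
      ≤ (‖v‖ + ‖u‖ + ‖u‖ * ‖v‖) ^ 2 := by gcongr
    _ ≤ 3 * (‖v‖ ^ 2 + ‖u‖ ^ 2 + ‖u‖ ^ 2 * ‖v‖ ^ 2) := by
        linarith [sq_nonneg (‖v‖ - ‖u‖), sq_nonneg (‖v‖ - ‖u‖ * ‖v‖),
          sq_nonneg (‖u‖ - ‖u‖ * ‖v‖)]
    _ ≤ 3 * (2 * q + q ^ 2) := by linarith

/-- Frobenius bound between the true and predicted Gram matrices: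
`∑_{ℓ,k} |Ĝ_{ℓ,k} − G_{ℓ,k}|² ≤ 3M²(2q + q²)`. -/
theorem gram_frobenius_perturbation
    {H : Type*} [NormedAddCommGroup H] [InnerProductSpace ℂ H]
    (M : ℕ) (hM : 1 ≤ M) (q : ℝ) (hq : 0 ≤ q)
    (ψ Δ : Fin M → H)
    (hψ : ∀ k, ‖ψ k‖ = 1) (hΔ : ∀ k, ‖Δ k‖ ^ 2 ≤ q)
    (G Ghat : Matrix (Fin M) (Fin M) ℂ)
    (hG : ∀ ℓ k, G ℓ k = ⟪ψ ℓ, ψ k⟫)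
    (hGhat : ∀ ℓ k, Ghat ℓ k = ⟪ψ ℓ + Δ ℓ, ψ k + Δ k⟫) :
    ∑ ℓ : Fin M, ∑ k : Fin M, ‖Ghat ℓ k - G ℓ k‖ ^ 2
      ≤ 3 * (M : ℝ) ^ 2 * (2 * q + q ^ 2) := by
  calc ∑ ℓ : Fin M, ∑ k : Fin M, ‖Ghat ℓ k - G ℓ k‖ ^ 2
      ≤ ∑ _ℓ : Fin M, ∑ _k : Fin M, 3 * (2 * q + q ^ 2) := by
        gcongr with ℓ _ k _
        rw [hG, hGhat]
        exact norm_inner_add_add_sub_inner_sq_le (hψ ℓ) (hψ k) (hΔ ℓ) (hΔ k)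
    _ = 3 * (M : ℝ) ^ 2 * (2 * q + q ^ 2) := by
        simp only [Finset.sum_const, Finset.card_univ, Fintype.card_fin, nsmul_eq_mul]
        ring
end
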